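/- Let a, b > 0 satisfy the nine inequalities 2a + b ≥ 1, 3a + 4b ≥ 2, 9a + 11b ≥ 6, a + 5b ≥ 1, 4a + 9b ≥ 3, 10a + 16b ≥ 7, 13a + 20b ≥ 8, 5a + 14b ≥ 4, a + (3/2)b ≥ 2/3. Let G be a graph with no triangle adjacent to a 4-cycle such that α(G) < |V(G)| − (a|V(G)| + b|E(G)| + bλ(G)), and suppose every graph G' with fewer vertices than G and no triangle adjacent to a 4-cycle satisfies α(G') ≥ |V(G')| − (a|V(G')| + b|E(G')| + bλ(G')). Then the maximum degree of G is at most four. -/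

import Mathlib

namespace Paper

/-- `s` is an independent set in the simple graph `G`. -/
def IsIndepSet {V : Type} (G : SimpleGraph V) (s : Finset V) : Prop :=
  ∀ v ∈ s, ∀ w ∈ s, ¬ G.Adj v w

/-- The independence number `α(G)`: the size of a largest independent set. -/
noncomputable def indepNum {V : Type} (G : SimpleGraph V) : ℕ :=
  sSup {n | ∃ s : Finset V, IsIndepSet G s ∧ s.card = n}

/-- The number of edges `|E(G)|`. -/
noncomputable def numEdges {V : Type} (G : SimpleGraph V) : ℕ :=
  Nat.card G.edgeSet

/-- The degree of a vertex. -/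
noncomputable def deg {V : Type} (G : SimpleGraph V) (v : V) : ℕ :=
  Nat.card (G.neighborSet v)

/-- `G` contains a triangle sharing a common edge with a 4-cycle:
the triangle `u v w` and the 4-cycle `u v x y` share the edge `u v`. -/
def HasTriangleAdjC4 {V : Type} (G : SimpleGraph V) : Prop :=
  ∃ u v w x y : V, G.Adj u v ∧ G.Adj v w ∧ G.Adj w u ∧
    G.Adj v x ∧ G.Adj x y ∧ G.Adj y u ∧ u ≠ x ∧ v ≠ y

/-- `G` contains two triangles sharing a common edge:
the triangles `u v w` and `u v x` share the edge `u v`. -/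
def HasAdjTriangles {V : Type} (G : SimpleGraph V) : Prop :=
  ∃ u v w x : V, G.Adj u v ∧ G.Adj v w ∧ G.Adj w u ∧
    G.Adj v x ∧ G.Adj x u ∧ w ≠ x

/-- `G` contains a triangle sharing a common edge with a 5-cycle:
the triangle `u v w` and the 5-cycle `u v x y z` share the edge `u v`. -/
def HasTriangleAdjC5 {V : Type} (G : SimpleGraph V) : Prop :=
  ∃ u v w x y z : V, G.Adj u v ∧ G.Adj v w ∧ G.Adj w u ∧
    G.Adj v x ∧ G.Adj x y ∧ G.Adj y z ∧ G.Adj z u ∧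
    u ≠ x ∧ u ≠ y ∧ v ≠ y ∧ v ≠ z ∧ x ≠ z

/-- The 2-chain of triangles: two disjoint triangles `{0,1,2}` and `{3,4,5}`
joined by the single edge `{2,3}` (6 vertices, 7 edges). -/
def chainGraph : SimpleGraph (Fin 6) :=
  SimpleGraph.fromRel (fun i j =>
    (i.val, j.val) ∈ [(0,1), (0,2), (1,2), (3,4), (3,5), (4,5), (2,3)])

/-- A connected component is difficult if it is a triangle or a 2-chain of triangles. -/
def IsDifficult {V : Type} (G : SimpleGraph V) (c : G.ConnectedComponent) : Prop :=
  Nonempty (SimpleGraph.induce c.supp G ≃g (⊤ : SimpleGraph (Fin 3))) ∨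
  Nonempty (SimpleGraph.induce c.supp G ≃g chainGraph)

/-- `λ(G)`: the number of difficult components of `G`. -/
noncomputable def lambda {V : Type} (G : SimpleGraph V) : ℕ :=
  Nat.card {c : G.ConnectedComponent // IsDifficult G c}

/-- `Φ(S)`: the number of edges of `G` with exactly one endpoint in `S`. -/
noncomputable def phi {V : Type} (G : SimpleGraph V) (S : Set V) : ℕ :=
  Nat.card {e : Sym2 V | e ∈ G.edgeSet ∧ ∃ x ∈ S, ∃ y, y ∉ S ∧ e = s(x, y)}

section

variable {V W U : Type}

theorem HasTriangleAdjC4.of_embedding {G : SimpleGraph V} {H : SimpleGraph W} (f : H ↪g G)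
    (h : HasTriangleAdjC4 H) : HasTriangleAdjC4 G := by
  obtain ⟨u, v, w, x, y, huv, hvw, hwu, hvx, hxy, hyu, hux, hvy⟩ := h
  exact ⟨f u, f v, f w, f x, f y, f.map_adj_iff.2 huv, f.map_adj_iff.2 hvw, f.map_adj_iff.2 hwu,
    f.map_adj_iff.2 hvx, f.map_adj_iff.2 hxy, f.map_adj_iff.2 hyu,
    f.injective.ne hux, f.injective.ne hvy⟩

/-- Two triangles sharing an edge give a triangle adjacent to a 4-cycle. -/
theorem hasTriangleAdjC4_of_two_triangles {G : SimpleGraph V} {p q r v : V} (hpq : G.Adj p q)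
    (hqr : G.Adj q r) (hrp : G.Adj r p) (hvp : G.Adj v p) (hvq : G.Adj v q) (hvr : v ≠ r) :
    HasTriangleAdjC4 G :=
  ⟨q, r, p, p, v, hqr, hrp, hpq, hrp, hvp.symm, hvq, hpq.ne', hvr.symm⟩

theorem bddAbove_indepSet_card [Fintype V] (G : SimpleGraph V) :
    BddAbove {n | ∃ s : Finset V, IsIndepSet G s ∧ s.card = n} :=
  ⟨Fintype.card V, by rintro _ ⟨s, -, rfl⟩; exact s.card_le_univ⟩

theorem exists_isIndepSet_card_eq_indepNum [Fintype V] (G : SimpleGraph V) :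
    ∃ s : Finset V, IsIndepSet G s ∧ s.card = indepNum G :=
  Nat.sSup_mem (s := {n | ∃ s : Finset V, IsIndepSet G s ∧ s.card = n})
    ⟨0, ∅, by simp [IsIndepSet]⟩ (bddAbove_indepSet_card G)

/-- An independent set whose closed neighbourhood is contained in `S` extends any independent
set of `G - S`. -/
theorem card_add_indepNum_induce_compl_le [Fintype V] (G : SimpleGraph V) (S : Set V)
    (I : Finset V) (hI : IsIndepSet G I) (hIS : ∀ x ∈ I, x ∈ S)
    (hN : ∀ x ∈ I, ∀ y, G.Adj x y → y ∈ S) :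
    I.card + indepNum (G.induce Sᶜ) ≤ indepNum G := by
  classical
  obtain ⟨s, hs, hcard⟩ := exists_isIndepSet_card_eq_indepNum (G.induce Sᶜ)
  refine le_csSup (bddAbove_indepSet_card G)
    ⟨I ∪ s.map (Function.Embedding.subtype _), ?_, ?_⟩
  · intro x hx y hy hxy
    simp only [Finset.mem_union, Finset.mem_map, Function.Embedding.subtype_apply] at hx hy
    rcases hx with hx | ⟨x, hx, rfl⟩ <;> rcases hy with hy | ⟨y, hy, rfl⟩
    · exact hI x hx y hy hxy
    · exact y.2 (hN x hx _ hxy)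
    · exact x.2 (hN y hy _ hxy.symm)
    · exact hs x hx y hy hxy
  · rw [Finset.card_union_of_disjoint, Finset.card_map, hcard]
    rw [Finset.disjoint_left]
    intro x hx hx'
    simp only [Finset.mem_map, Function.Embedding.subtype_apply] at hx'
    obtain ⟨y, -, rfl⟩ := hx'
    exact y.2 (hIS _ hx)

/-- Edges inside two disjoint induced subgraphs, together with the edges from a vertex outside
the first one to the first one, are pairwise distinct. -/
theorem numEdges_add_numEdges_add_card_le [Finite V] {G : SimpleGraph V} {H : SimpleGraph W}
    {K : SimpleGraph U} (f : K ↪g G) (g : H ↪g G) (hfg : ∀ i j, f i ≠ g j) (v : V)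
    (hv : ∀ i, f i ≠ v) :
    numEdges K + numEdges H + Nat.card {i // G.Adj v (f i)} ≤ numEdges G := by
  have : Finite U := Finite.of_injective f f.injective
  have : Finite W := Finite.of_injective g g.injective
  let F : (K.edgeSet ⊕ H.edgeSet) ⊕ {i // G.Adj v (f i)} → G.edgeSet :=
    Sum.elim (Sum.elim f.mapEdgeSet g.mapEdgeSet) fun i => ⟨s(v, f i), i.2⟩
  have hF : Function.Injective F := by
    refine (f.mapEdgeSet.injective.sumElim g.mapEdgeSet.injective ?_).sumElim ?_ ?_
    · rintro ⟨e, he⟩ ⟨e', he'⟩ h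
      induction e with | _ x y
      induction e' with | _ z w
      have h' : s(f x, f y) = s(g z, g w) := congrArg Subtype.val h
      rw [Sym2.eq_iff] at h'
      grind
    · intro i j h
      have h' : s(v, f i) = s(v, f j) := congrArg Subtype.val h
      exact Subtype.ext (f.injective (Sym2.congr_right.1 h'))
    · rintro (⟨e, he⟩ | ⟨e, he⟩) i h
      · induction e with | _ x y
        have h' : s(f x, f y) = s(v, f i) := congrArg Subtype.val h
        rw [Sym2.eq_iff] at h'
        grind
      · induction e with | _ x y
        have h' : s(g x, g y) = s(v, f i) := congrArg Subtype.val h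
        rw [Sym2.eq_iff] at h'
        grind
  simpa only [numEdges, Nat.card_sum] using Nat.card_le_card_of_injective F hF

/-- A component of `G - S` with no neighbour in `S` is a component of `G`. -/
theorem supp_map_induce_eq {G : SimpleGraph V} {T : Set V} (c : (G.induce T).ConnectedComponent)
    (hc : ∀ x ∈ c.supp, ∀ y, G.Adj x y → y ∈ T) :
    (c.map (SimpleGraph.Embedding.induce T).toHom).supp = Subtype.val '' c.supp := by
  induction c using SimpleGraph.ConnectedComponent.ind with | _ x
  ext y
  simp only [SimpleGraph.ConnectedComponent.mem_supp_iff, Set.mem_image] at hc ⊢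
  constructor
  · intro h
    have h : G.Reachable y x := SimpleGraph.ConnectedComponent.exact h
    obtain ⟨p⟩ := h.symm
    have key : ∀ {u w : V} (p : G.Walk u w) (hu : u ∈ T),
        (G.induce T).connectedComponentMk ⟨u, hu⟩ = (G.induce T).connectedComponentMk x →
        ∃ z, (G.induce T).connectedComponentMk z = (G.induce T).connectedComponentMk x ∧
          z.1 = w := by
      intro u w p
      induction p with
      | nil => exact fun hu h => ⟨_, h, rfl⟩
      | @cons u u' w hadj p ih =>
        intro hu h
        have hu' : u' ∈ T := hc _ h _ hadj
        refine ih hu' (Eq.trans (SimpleGraph.ConnectedComponent.sound ?_) h)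
        exact SimpleGraph.Adj.reachable (G := G.induce T) (u := ⟨u', hu'⟩) (v := ⟨u, hu⟩) hadj.symm
    exact key p x.2 rfl
  · rintro ⟨z, hz, rfl⟩
    have := congrArg
      (SimpleGraph.ConnectedComponent.map (SimpleGraph.Embedding.induce (G := G) T).toHom) hz
    exact this

theorem isDifficult_map_induce {G : SimpleGraph V} {T : Set V}
    (c : (G.induce T).ConnectedComponent) (hd : IsDifficult (G.induce T) c)
    (hc : ∀ x ∈ c.supp, ∀ y, G.Adj x y → y ∈ T) :
    IsDifficult G (c.map (SimpleGraph.Embedding.induce T).toHom) := by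
  have e : Nonempty (G.induce (c.map (SimpleGraph.Embedding.induce T).toHom).supp ≃g
      (G.induce T).induce c.supp) := by
    rw [supp_map_induce_eq c hc]
    exact ⟨⟨(Equiv.Set.image _ c.supp Subtype.val_injective).symm, by
      intro p q
      obtain ⟨p, rfl⟩ := (Equiv.Set.image _ c.supp Subtype.val_injective).surjective p
      obtain ⟨q, rfl⟩ := (Equiv.Set.image _ c.supp Subtype.val_injective).surjective q
      rw [Equiv.symm_apply_apply, Equiv.symm_apply_apply]
      rfl⟩⟩
  obtain ⟨e⟩ := e
  exact hd.imp (fun ⟨i⟩ => ⟨e.trans i⟩) (fun ⟨i⟩ => ⟨e.trans i⟩)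

/-- Passing to `G[T]` creates at most as many difficult components as there are difficult
components of `G[T]` with a neighbour outside `T`. -/
theorem lambda_induce_le [Finite V] (G : SimpleGraph V) (T : Set V) :
    lambda (G.induce T) ≤ lambda G + Nat.card {c : (G.induce T).ConnectedComponent //
      IsDifficult (G.induce T) c ∧ ∃ x ∈ c.supp, ∃ y, G.Adj x y ∧ y ∉ T} := by
  classical
  let F : {c : (G.induce T).ConnectedComponent // IsDifficult (G.induce T) c} →
      {c : G.ConnectedComponent // IsDifficult G c} ⊕
      {c : (G.induce T).ConnectedComponent //
        IsDifficult (G.induce T) c ∧ ∃ x ∈ c.supp, ∃ y, G.Adj x y ∧ y ∉ T} := fun c =>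
    if h : ∃ x ∈ c.1.supp, ∃ y, G.Adj x y ∧ y ∉ T then Sum.inr ⟨c.1, c.2, h⟩
    else Sum.inl ⟨_, isDifficult_map_induce c.1 c.2 (by push Not at h; exact h)⟩
  have hF : Function.Injective F := by
    intro c d h
    by_cases hc : ∃ x ∈ c.1.supp, ∃ y, G.Adj x y ∧ y ∉ T <;>
    by_cases hd : ∃ x ∈ d.1.supp, ∃ y, G.Adj x y ∧ y ∉ T <;>
    simp only [F, hc, hd, dite_true, dite_false, reduceCtorEq, Sum.inr.injEq, Sum.inl.injEq,
      Subtype.mk.injEq] at h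
    · exact Subtype.ext h
    · push Not at hc hd
      have hs := congrArg SimpleGraph.ConnectedComponent.supp h
      rw [supp_map_induce_eq _ hc, supp_map_induce_eq _ hd] at hs
      exact Subtype.ext (SimpleGraph.ConnectedComponent.supp_injective
        (Subtype.val_injective.image_injective hs))
  simpa only [lambda, Nat.card_sum] using Nat.card_le_card_of_injective F hF

instance : DecidableRel chainGraph.Adj := fun i j => by
  unfold chainGraph; infer_instance

theorem numEdges_top_fin_three : numEdges (⊤ : SimpleGraph (Fin 3)) = 3 := by
  rw [numEdges, Nat.card_eq_fintype_card]; decide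

theorem numEdges_chainGraph : numEdges chainGraph = 7 := by
  rw [numEdges, Nat.card_eq_fintype_card]; decide

theorem deg_top_fin_three_le (i : Fin 3) : deg (⊤ : SimpleGraph (Fin 3)) i ≤ 3 := by
  rw [deg, Nat.card_eq_fintype_card]; revert i; decide

theorem deg_chainGraph_le (i : Fin 6) : deg chainGraph i ≤ 3 := by
  rw [deg, Nat.card_eq_fintype_card]; revert i; decide

/-- Vertices of a difficult component have degree at most three. -/
theorem IsDifficult.deg_le [Finite V] {G : SimpleGraph V} {c : G.ConnectedComponent}
    (hc : IsDifficult G c) {v : V} (hv : v ∈ c.supp) : deg G v ≤ 3 := by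
  have key : ∀ {n : ℕ} {K : SimpleGraph (Fin n)} (_ : ∀ i, deg K i ≤ 3)
      (_ : G.induce c.supp ≃g K), deg G v ≤ 3 := by
    intro n K hK e
    have hmem : ∀ w, G.Adj v w → w ∈ c.supp := fun w hw =>
      (SimpleGraph.ConnectedComponent.mem_supp_congr_adj c hw).1 hv
    refine le_trans ?_ (hK (e ⟨v, hv⟩))
    refine Nat.card_le_card_of_injective
      (fun w : G.neighborSet v => (⟨e ⟨w, hmem w w.2⟩, e.map_adj_iff.2 w.2⟩ :
        K.neighborSet (e ⟨v, hv⟩))) ?_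
    intro x y h
    have := e.injective (congrArg Subtype.val h)
    exact Subtype.ext (by simpa using this)
  rcases hc with ⟨⟨e⟩⟩ | ⟨⟨e⟩⟩
  · exact key deg_top_fin_three_le e
  · exact key deg_chainGraph_le e

/-- A difficult component of `G - v` consists of `t` triangles, has `4 * t - 1` edges, and
contains an independent set of size `t` avoiding the neighbours of `v`. -/
theorem IsDifficult.exists_embedding {G : SimpleGraph V} (hG : ¬ HasTriangleAdjC4 G) {v : V}
    {c : (G.induce {v}ᶜ).ConnectedComponent} (hc : IsDifficult (G.induce {v}ᶜ) c) :
    ∃ (t n : ℕ) (K : SimpleGraph (Fin n)) (f : K ↪g G), n = 3 * t ∧ numEdges K + 1 = 4 * t ∧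
      Set.range f = Subtype.val '' c.supp ∧
      ∃ I : Finset (Fin n), IsIndepSet K I ∧ I.card = t ∧ ∀ i ∈ I, ¬ G.Adj v (f i) := by
  have emb : ∀ {n : ℕ} {K : SimpleGraph (Fin n)} (_ : (G.induce {v}ᶜ).induce c.supp ≃g K),
      ∃ f : K ↪g G, Set.range f = Subtype.val '' c.supp := by
    intro n K e
    refine ⟨((SimpleGraph.Embedding.induce _).comp (SimpleGraph.Embedding.induce _)).comp
      e.symm.toEmbedding, ?_⟩
    ext y
    constructor
    · rintro ⟨i, rfl⟩
      exact ⟨_, (e.symm i).2, rfl⟩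
    · rintro ⟨x, hx, rfl⟩
      exact ⟨e ⟨x, hx⟩, congrArg (fun z => z.1.1) (e.symm_apply_apply ⟨x, hx⟩)⟩
  have pick : ∀ {n : ℕ} {K : SimpleGraph (Fin n)} (f : K ↪g G)
      (_ : Set.range f = Subtype.val '' c.supp) (i j k : Fin n) (_ : K.Adj i j) (_ : K.Adj j k)
      (_ : K.Adj k i), ∃ l, (l = i ∨ l = j) ∧ ¬ G.Adj v (f l) := by
    intro n K f hf i j k hij hjk hki
    by_contra! h
    refine hG (hasTriangleAdjC4_of_two_triangles (f.map_adj_iff.2 hij) (f.map_adj_iff.2 hjk)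
      (f.map_adj_iff.2 hki) (h i (.inl rfl)) (h j (.inr rfl)) ?_)
    intro hvk
    obtain ⟨x, -, hx⟩ : f k ∈ Subtype.val '' c.supp := hf ▸ ⟨k, rfl⟩
    exact x.2 (hx.trans hvk.symm)
  rcases hc with ⟨⟨e⟩⟩ | ⟨⟨e⟩⟩
  · obtain ⟨f, hf⟩ := emb e
    obtain ⟨l, -, hl⟩ := pick f hf 0 1 2 (by decide) (by decide) (by decide)
    exact ⟨1, 3, _, f, rfl, by rw [numEdges_top_fin_three], hf, {l}, by simp [IsIndepSet],
      by simp, by simpa using hl⟩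
  · obtain ⟨f, hf⟩ := emb e
    obtain ⟨l, hl, hlv⟩ := pick f hf 0 1 2 (by decide) (by decide) (by decide)
    obtain ⟨m, hm, hmv⟩ := pick f hf 4 5 3 (by decide) (by decide) (by decide)
    refine ⟨2, 6, _, f, rfl, by rw [numEdges_chainGraph], hf, {l, m}, ?_, ?_, ?_⟩
    · unfold IsIndepSet
      rcases hl with rfl | rfl <;> rcases hm with rfl | rfl <;> decide
    · rcases hl with rfl | rfl <;> rcases hm with rfl | rfl <;> decide
    · simp [hlv, hmv]

/-- The inequality obtained in a minimum counterexample by deleting `S` and adding to an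
independent set of `G - S` a set `I` whose closed neighbourhood lies in `S`. -/
theorem lt_card_sub_card_of_counterexample {a b : ℝ} (hb : 0 < b) [Fintype V]
    (G : SimpleGraph V) (hG : ¬ HasTriangleAdjC4 G)
    (hcex : (indepNum G : ℝ) <
      (Nat.card V : ℝ) - (a * Nat.card V + b * numEdges G + b * lambda G))
    (hmin : ∀ (W : Type) [Fintype W] (G' : SimpleGraph W),
      Nat.card W < Nat.card V → ¬ HasTriangleAdjC4 G' →
      (indepNum G' : ℝ) ≥
        (Nat.card W : ℝ) - (a * Nat.card W + b * numEdges G' + b * lambda G'))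
    (S : Set V) (hS : S.Nonempty) (I : Finset V) (hI : IsIndepSet G I) (hIS : ∀ x ∈ I, x ∈ S)
    (hN : ∀ x ∈ I, ∀ y, G.Adj x y → y ∈ S) (e l : ℕ)
    (he : e + numEdges (G.induce Sᶜ) ≤ numEdges G)
    (hl : lambda (G.induce Sᶜ) ≤ lambda G + l) :
    a * Nat.card S + b * (e - l) < Nat.card S - I.card := by
  classical
  have hcard : Nat.card S + Nat.card ↥Sᶜ = Nat.card V := by
    simpa only [Nat.card_sum] using Nat.card_congr (Equiv.Set.sumCompl S)
  have hpos : 0 < Nat.card S := have := hS.to_subtype; Nat.card_pos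
  have hind := hmin ↥Sᶜ (G.induce Sᶜ) (by lia)
    (fun h => hG (h.of_embedding (SimpleGraph.Embedding.induce Sᶜ)))
  have hα := card_add_indepNum_induce_compl_le G S I hI hIS hN
  have hcard' : (Nat.card S : ℝ) + Nat.card ↥Sᶜ = Nat.card V := mod_cast hcard
  have hα' : (I.card : ℝ) + indepNum (G.induce Sᶜ) ≤ indepNum G := mod_cast hα
  have he' : (e : ℝ) + numEdges (G.induce Sᶜ) ≤ numEdges G := mod_cast he
  have hl' : (lambda (G.induce Sᶜ) : ℝ) ≤ lambda G + l := mod_cast hl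
  rw [← hcard'] at hcex
  nlinarith [mul_le_mul_of_nonneg_left he' hb.le, mul_le_mul_of_nonneg_left hl' hb.le]

/-- In a minimum counterexample, deleting a vertex of degree at least five leaves no difficult
component adjacent to that vertex. -/
theorem not_adj_difficult_component {a b : ℝ} (hb : 0 < b) (h2 : 3 * a + 4 * b ≥ 2)
    [Fintype V] (G : SimpleGraph V) (hG : ¬ HasTriangleAdjC4 G)
    (hcex : (indepNum G : ℝ) <
      (Nat.card V : ℝ) - (a * Nat.card V + b * numEdges G + b * lambda G))
    (hmin : ∀ (W : Type) [Fintype W] (G' : SimpleGraph W),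
      Nat.card W < Nat.card V → ¬ HasTriangleAdjC4 G' →
      (indepNum G' : ℝ) ≥
        (Nat.card W : ℝ) - (a * Nat.card W + b * numEdges G' + b * lambda G'))
    {v : V} (hv : 5 ≤ deg G v) (c : (G.induce {v}ᶜ).ConnectedComponent)
    (hc : IsDifficult (G.induce {v}ᶜ) c) : ∀ x ∈ c.supp, ¬ G.Adj v x := by
  classical
  intro x hx hvx
  obtain ⟨t, n, K, f, hn, hK, hf, I, hI, hIt, hIv⟩ := hc.exists_embedding hG
  have hvf : ∀ i, f i ≠ v := by
    intro i hi
    obtain ⟨y, -, hy⟩ : f i ∈ Subtype.val '' c.supp := hf ▸ ⟨i, rfl⟩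
    exact y.2 (hy.trans hi)
  have hclosed : ∀ i y, G.Adj (f i) y → y ≠ v → y ∈ Set.range f := by
    intro i y hiy hyv
    obtain ⟨z, hz, hzi⟩ : f i ∈ Subtype.val '' c.supp := hf ▸ ⟨i, rfl⟩
    rw [hf]
    rw [← hzi] at hiy
    exact ⟨⟨y, hyv⟩, (SimpleGraph.ConnectedComponent.mem_supp_congr_adj c
      (v := z) (w := ⟨y, hyv⟩) hiy).1 hz, rfl⟩
  obtain ⟨i₀, hi₀⟩ : (x : V) ∈ Set.range f := hf ▸ ⟨x, hx, rfl⟩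
  set S : Set V := Set.range f
  have hvS : v ∈ Sᶜ := fun ⟨i, hi⟩ => hvf i hi
  have hSn : Nat.card S = n := by
    simpa using (Nat.card_congr (Equiv.ofInjective f f.injective)).symm
  set k := Nat.card {i // G.Adj v (f i)}
  set H := G.induce Sᶜ
  let B := {d : H.ConnectedComponent //
      IsDifficult H d ∧ ∃ x ∈ d.supp, ∃ y, G.Adj x y ∧ y ∉ Sᶜ}
  have hB : ∀ d : B, d.1 = H.connectedComponentMk ⟨v, hvS⟩ := by
    rintro ⟨d, -, z, hz, y, hzy, hy⟩
    obtain ⟨i, rfl⟩ := not_not.1 hy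
    have hzv : z = ⟨v, hvS⟩ := by
      by_contra h
      exact z.2 (hclosed i z hzy.symm fun h' => h (Subtype.ext h'))
    exact hzv ▸ (SimpleGraph.ConnectedComponent.mem_supp_iff _ _ |>.1 hz).symm
  have hdeg : deg G v ≤ deg H ⟨v, hvS⟩ + k := by
    let F : G.neighborSet v → H.neighborSet ⟨v, hvS⟩ ⊕ {i // G.Adj v (f i)} := fun w =>
      if h : w.1 ∈ S then Sum.inr ⟨h.choose, by rw [h.choose_spec]; exact w.2⟩
      else Sum.inl ⟨⟨w.1, h⟩, w.2⟩
    let F' : H.neighborSet ⟨v, hvS⟩ ⊕ {i // G.Adj v (f i)} → V :=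
      Sum.elim (fun w => w.1.1) (fun i => f i)
    have hF : ∀ w, F' (F w) = w.1 := by
      intro w
      by_cases h : w.1 ∈ S
      · simp only [F, F', h, dite_true, Sum.elim_inr]
        exact h.choose_spec
      · simp only [F, F', h, dite_false, Sum.elim_inl]
    have hFinj : Function.Injective F := fun w w' h =>
      Subtype.ext (by rw [← hF, ← hF, h])
    simpa only [deg, Nat.card_sum] using Nat.card_le_card_of_injective F hFinj
  have hk : 1 ≤ k := by
    have : Nonempty {i // G.Adj v (f i)} := ⟨⟨i₀, by rw [hi₀]; exact hvx⟩⟩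
    exact Nat.card_pos
  have hBk : Nat.card B + 1 ≤ k := by
    have : Subsingleton B := ⟨fun d d' => Subtype.ext ((hB d).trans (hB d').symm)⟩
    rcases isEmpty_or_nonempty B with h | ⟨⟨d⟩⟩
    · simpa using hk
    · have h3 := d.2.1.deg_le (v := ⟨v, hvS⟩) (by rw [hB d]; rfl)
      have := Finite.card_le_one_iff_subsingleton.2 this
      lia
  have hedge := numEdges_add_numEdges_add_card_le f (SimpleGraph.Embedding.induce Sᶜ)
    (fun i j h => j.2 ⟨i, h⟩) v hvf
  have hlam := lambda_induce_le G Sᶜ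
  have key := lt_card_sub_card_of_counterexample hb G hG hcex hmin S ⟨_, i₀, rfl⟩
    (I.map f.toEmbedding) ?_ ?_ ?_ (numEdges K + k) (Nat.card B) (by lia) hlam
  · rw [hSn, Finset.card_map, hIt] at key
    have hn' : (n : ℝ) = 3 * t := mod_cast hn
    have hK' : (numEdges K : ℝ) + 1 = 4 * t := mod_cast hK
    have hBk' : (Nat.card B : ℝ) + 1 ≤ k := mod_cast hBk
    rw [hn'] at key
    push_cast at key
    nlinarith [mul_le_mul_of_nonneg_left h2 t.cast_nonneg,
      mul_le_mul_of_nonneg_left hBk' hb.le]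
  · intro p hp q hq hpq
    obtain ⟨i, hi, rfl⟩ := Finset.mem_map.1 hp
    obtain ⟨j, hj, rfl⟩ := Finset.mem_map.1 hq
    exact hI i hi j hj (f.map_adj_iff.1 hpq)
  · intro p hp
    obtain ⟨i, hi, rfl⟩ := Finset.mem_map.1 hp
    exact ⟨i, rfl⟩
  · intro p hp y hy
    obtain ⟨i, hi, rfl⟩ := Finset.mem_map.1 hp
    refine hclosed i y hy ?_
    rintro rfl
    exact hIv i hi hy.symm

end

/-- Claim 2.9: the maximum degree of a minimum counterexample is at most four. -/
theorem claim_max_degree_four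
(a b : ℝ) (ha : 0 < a) (hb : 0 < b)
    (h1 : 2 * a + b ≥ 1) (h2 : 3 * a + 4 * b ≥ 2) (h3 : 9 * a + 11 * b ≥ 6)
    (h4 : a + 5 * b ≥ 1) (h5 : 4 * a + 9 * b ≥ 3) (h6 : 10 * a + 16 * b ≥ 7)
    (h7 : 13 * a + 20 * b ≥ 8) (h8 : 5 * a + 14 * b ≥ 4)
    (h9 : a + (3 / 2) * b ≥ 2 / 3)
{V : Type} [Fintype V] (G : SimpleGraph V)
    (hG : ¬ HasTriangleAdjC4 G)
    (hcex : (indepNum G : ℝ) <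
      (Nat.card V : ℝ) - (a * Nat.card V + b * numEdges G + b * lambda G))
    (hmin : ∀ (W : Type) [Fintype W] (G' : SimpleGraph W),
      Nat.card W < Nat.card V → ¬ HasTriangleAdjC4 G' →
      (indepNum G' : ℝ) ≥
        (Nat.card W : ℝ) - (a * Nat.card W + b * numEdges G' + b * lambda G')) :
    ∀ v : V, deg G v ≤ 4 := by
  intro v
  by_contra! hv
  have hlam := lambda_induce_le G {v}ᶜ
  have hedge := numEdges_add_numEdges_add_card_le (SimpleGraph.Embedding.induce (G := G) {v}ᶜ)
    (SimpleGraph.Embedding.induce (G := G) {v}) (fun i j h => i.2 (h.trans j.2)) v (fun i => i.2)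
  have hempty : IsEmpty {c : (G.induce {v}ᶜ).ConnectedComponent //
      IsDifficult (G.induce {v}ᶜ) c ∧ ∃ x ∈ c.supp, ∃ y, G.Adj x y ∧ y ∉ ({v}ᶜ : Set V)} := by
    refine ⟨?_⟩
    rintro ⟨c, hc, x, hx, y, hxy, hy⟩
    obtain rfl : y = v := not_not.1 hy
    exact not_adj_difficult_component hb h2 G hG hcex hmin hv c hc x hx hxy.symm
  have hdeg : deg G v ≤ Nat.card {i : ({v}ᶜ : Set V) // G.Adj v i} :=
    Nat.card_le_card_of_injective
      (fun w : G.neighborSet v =>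
        (⟨⟨w, w.2.ne'⟩, w.2⟩ : {i : ({v}ᶜ : Set V) // G.Adj v i}))
      fun w w' h => Subtype.ext (congrArg (fun z => z.1.1) h)
  have hdeg' : deg G v + numEdges (G.induce {v}ᶜ) ≤ numEdges G := by
    refine le_trans ?_ hedge
    exact (Nat.add_le_add_right hdeg _).trans (by simp; lia)
  have key := lt_card_sub_card_of_counterexample hb G hG hcex hmin {v} ⟨v, rfl⟩ ∅
    (by simp [IsIndepSet]) (by simp) (by simp) (deg G v) 0 hdeg'
    (by rwa [Nat.card_of_isEmpty] at hlam)
  have hv' : (5 : ℝ) ≤ deg G v := mod_cast hv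
  simp only [Nat.card_unique, Nat.cast_one, Nat.cast_zero, Finset.card_empty] at key
  nlinarith [mul_le_mul_of_nonneg_left hv' hb.le]

end Paper
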